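/- arXiv:1208.6286 — 2 statements merged into one kernel-verified Lean document; each statement's English description precedes it below -/
import Mathlib

section
/- Let c ∈ ℭ_+(N) and P ∈ 𝔓_+(N). Then the functional J_P attains its minimum over 𝔓_+(N) at a unique point Q̂ ∈ 𝔓_+(N), and the function Φ defined by Φ(ζ_j) := P(ζ_j)/Q̂(ζ_j) satisfies the moment conditions for c. -/
open Complex Finset Filter Topology

noncomputable section

/-- Coefficient space for symmetric trigonometric polynomials of degree `n`:
`(p₀, (p₁, …, pₙ))` with `p₀` real and `p₋ₖ = conj pₖ` implicit. Also used for
covariance data `c = (c₀, (c₁, …, cₙ))`. -/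
abbrev Coef (n : ℕ) := ℝ × (Fin n → ℂ)

/-- The `2N`-th roots of unity `ζ_j = exp(iπj/N)`. -/
def zet (N : ℕ) (j : ℤ) : ℂ := Complex.exp (Real.pi * Complex.I * j / N)

/-- The index set `j = -N+1, …, N`. -/
def idxs (N : ℕ) : Finset ℤ := Finset.Icc (-(N : ℤ) + 1) N

/-- Evaluation of `P(z) = Σ_{k=-n}^n p_k z^{-k}` (with `p₋ₖ = conj pₖ`). -/
def evalC {n : ℕ} (p : Coef n) (z : ℂ) : ℂ :=
  (p.1 : ℂ) + ∑ k : Fin n,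
    (p.2 k * z⁻¹ ^ ((k : ℕ) + 1) + (starRingEnd ℂ) (p.2 k) * z ^ ((k : ℕ) + 1))

/-- Real value of the symmetric trigonometric polynomial on the unit circle. -/
def evalR {n : ℕ} (p : Coef n) (z : ℂ) : ℝ := (evalC p z).re

/-- The open cone `𝔓₊(N)`. -/
def Pplus (n N : ℕ) : Set (Coef n) := {p | ∀ j ∈ idxs N, 0 < evalR p (zet N j)}

/-- The closure of `𝔓₊(N)`: `P(ζ_j) ≥ 0` for all `j`. -/
def Pnn (n N : ℕ) : Set (Coef n) := {p | ∀ j ∈ idxs N, 0 ≤ evalR p (zet N j)}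

/-- The cone `𝔓₊` of trigonometric polynomials positive on the whole circle. -/
def PplusC (n : ℕ) : Set (Coef n) :=
  {p | ∀ θ ∈ Set.Icc (-Real.pi) Real.pi, 0 < evalR p (Complex.exp (θ * Complex.I))}

/-- The closure of `𝔓₊`: nonnegative on the whole circle. -/
def PnnC (n : ℕ) : Set (Coef n) :=
  {p | ∀ θ ∈ Set.Icc (-Real.pi) Real.pi, 0 ≤ evalR p (Complex.exp (θ * Complex.I))}

/-- The pairing `⟨C,P⟩ = Σ_{k=-n}^n c_k conj(p_k)` (a real number). -/
def pairCP {n : ℕ} (c p : Coef n) : ℝ :=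
  c.1 * p.1 + ∑ k : Fin n, 2 * (c.2 k * (starRingEnd ℂ) (p.2 k)).re

/-- The open dual cone `ℭ₊(N)`. -/
def Cplus (n N : ℕ) : Set (Coef n) := {c | ∀ p ∈ Pnn n N, p ≠ 0 → 0 < pairCP c p}

/-- The open dual cone `ℭ₊`. -/
def CplusC (n : ℕ) : Set (Coef n) := {c | ∀ p ∈ PnnC n, p ≠ 0 → 0 < pairCP c p}

/-- The discrete moment `(1/(2N)) Σ_j ζ_j^k Φ(ζ_j)`. -/
def dmom (N : ℕ) (Φ : ℤ → ℝ) (k : ℤ) : ℂ :=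
  (1 / (2 * (N : ℂ))) * ∑ j ∈ idxs N, zet N j ^ k * (Φ j : ℂ)

/-- `Φ` (a function of the index `j`) satisfies the moment conditions for `c`. -/
def MomCond {n : ℕ} (N : ℕ) (c : Coef n) (Φ : ℤ → ℝ) : Prop :=
  dmom N Φ 0 = (c.1 : ℂ) ∧ ∀ k : Fin n, dmom N Φ ((k : ℕ) + 1) = c.2 k

/-- The function `j ↦ P(ζ_j)/Q(ζ_j)`. -/
def phiOf {n : ℕ} (N : ℕ) (P Q : Coef n) : ℤ → ℝ :=
  fun j => evalR P (zet N j) / evalR Q (zet N j)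

/-- The dual functional `J_P(Q) = ⟨C,Q⟩ − (1/(2N)) Σ_j P(ζ_j) log Q(ζ_j)`. -/
def JP {n : ℕ} (N : ℕ) (c P Q : Coef n) : ℝ :=
  pairCP c Q - (1 / (2 * (N : ℝ))) * ∑ j ∈ idxs N,
    evalR P (zet N j) * Real.log (evalR Q (zet N j))

/-- The moment map `F^P`, with components `F^P_k(Q) = (1/(2N)) Σ_j ζ_j^k P(ζ_j)/Q(ζ_j)`. -/
def Fmap {n : ℕ} (N : ℕ) (P Q : Coef n) : Coef n :=
  ((dmom N (phiOf N P Q) 0).re, fun k => dmom N (phiOf N P Q) ((k : ℕ) + 1))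

/-- The derivative along a line of a linear functional minus a weighted sum of logarithms. -/
lemma hasDerivAt_sub_sum_log {E ι : Type*} [NormedAddCommGroup E] [NormedSpace ℝ E]
    (s : Finset ι) (q : ι → E →L[ℝ] ℝ) (L : E →L[ℝ] ℝ) (a : ι → ℝ)
    {x : E} (hx : ∀ j ∈ s, 0 < q j x) (h : E) :
    HasDerivAt (fun t : ℝ => L (x + t • h) - ∑ j ∈ s, a j * Real.log (q j (x + t • h)))
      (L h - ∑ j ∈ s, a j * (q j h / q j x)) 0 := by
  have hline : ∀ f : E →L[ℝ] ℝ, HasDerivAt (fun t : ℝ => f (x + t • h)) (f h) 0 := by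
    intro f
    have h1 : HasDerivAt (fun t : ℝ => x + t • h) h 0 := by
      simpa using ((hasDerivAt_id (0 : ℝ)).smul_const h).const_add x
    exact f.hasFDerivAt.comp_hasDerivAt 0 h1
  refine (hline L).fun_sub (HasDerivAt.fun_sum fun j hj => ?_)
  have h2 := (hline (q j)).log (by simpa using (hx j hj).ne')
  simpa using h2.const_mul (a j)

/-- First-order optimality for a linear functional minus a weighted sum of logarithms. -/
lemma eq_sum_div_of_isMin_sub_sum_log {E ι : Type*} [NormedAddCommGroup E] [NormedSpace ℝ E]
    (s : Finset ι) (q : ι → E →L[ℝ] ℝ) (L : E →L[ℝ] ℝ) (a : ι → ℝ)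
    {x : E} (hx : ∀ j ∈ s, 0 < q j x)
    (hmin : ∀ y, (∀ j ∈ s, 0 < q j y) →
      L x - ∑ j ∈ s, a j * Real.log (q j x) ≤ L y - ∑ j ∈ s, a j * Real.log (q j y)) (h : E) :
    L h = ∑ j ∈ s, a j * (q j h / q j x) := by
  have hloc : IsLocalMin
      (fun t : ℝ => L (x + t • h) - ∑ j ∈ s, a j * Real.log (q j (x + t • h))) 0 := by
    have hev : ∀ᶠ t : ℝ in 𝓝 0, ∀ j ∈ s, 0 < q j (x + t • h) := by
      rw [Filter.eventually_all_finset]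
      intro j hj
      have hc : Continuous fun t : ℝ => q j (x + t • h) := by fun_prop
      exact hc.continuousAt.eventually_const_lt (by simpa using hx j hj)
    filter_upwards [hev] with t ht
    simpa using hmin _ ht
  exact sub_eq_zero.1 (hloc.hasDerivAt_eq_zero (hasDerivAt_sub_sum_log s q L a hx h))

/-- A linear functional that is positive on the nonzero points of a closed polyhedral cone
dominates a positive multiple of the norm there. -/
lemma exists_pos_mul_norm_le_of_pos_on_cone {E ι : Type*} [NormedAddCommGroup E]
    [NormedSpace ℝ E] [FiniteDimensional ℝ E] (s : Finset ι) (q : ι → E →L[ℝ] ℝ) (L : E →L[ℝ] ℝ)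
    (hL : ∀ x, (∀ j ∈ s, 0 ≤ q j x) → x ≠ 0 → 0 < L x) :
    ∃ δ > 0, ∀ x, (∀ j ∈ s, 0 ≤ q j x) → δ * ‖x‖ ≤ L x := by
  have : ProperSpace E := FiniteDimensional.proper ℝ E
  set K : Set E := Metric.sphere 0 1 ∩ {x | ∀ j ∈ s, 0 ≤ q j x} with hK
  have hclosed : IsClosed {x : E | ∀ j ∈ s, 0 ≤ q j x} := by
    simp only [Set.ofPred_forall]
    exact isClosed_biInter fun j _ => isClosed_le continuous_const (q j).continuous
  have hKc : IsCompact K := (isCompact_sphere _ _).inter_right hclosed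
  have hscale : ∀ x, (∀ j ∈ s, 0 ≤ q j x) → x ≠ 0 → ‖x‖⁻¹ • x ∈ K := by
    intro x hx hx0
    refine ⟨by simp [norm_smul, hx0], fun j hj => ?_⟩
    rw [map_smul, smul_eq_mul]
    exact mul_nonneg (by positivity) (hx j hj)
  obtain ⟨δ, hδ, hle⟩ : ∃ δ > 0, ∀ x ∈ K, δ ≤ L x := by
    rcases K.eq_empty_or_nonempty with hemp | hne
    · exact ⟨1, one_pos, by simp [hemp]⟩
    · obtain ⟨x₁, hx₁, hmin⟩ := hKc.exists_isMinOn hne L.continuous.continuousOn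
      refine ⟨L x₁, hL x₁ hx₁.2 ?_, fun x hx => hmin hx⟩
      rintro rfl
      simpa using hx₁.1
  refine ⟨δ, hδ, fun x hx => ?_⟩
  by_cases hx0 : x = 0
  · simp [hx0]
  · have h1 := hle _ (hscale x hx hx0)
    have hpos : 0 < ‖x‖ := norm_pos_iff.2 hx0
    rw [map_smul, smul_eq_mul, inv_mul_eq_div, le_div_iff₀ hpos] at h1
    exact h1

/-- A linear functional minus a positively weighted sum of logarithms attains its minimum over
an open polyhedral cone, provided the functional is positive on the closed cone. -/
lemma exists_isMin_sub_sum_log {E ι : Type*} [NormedAddCommGroup E] [NormedSpace ℝ E]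
    [FiniteDimensional ℝ E] (s : Finset ι) (q : ι → E →L[ℝ] ℝ) (L : E →L[ℝ] ℝ) (a : ι → ℝ)
    (ha : ∀ j ∈ s, 0 < a j)
    (hL : ∀ x, (∀ j ∈ s, 0 ≤ q j x) → x ≠ 0 → 0 < L x)
    {x₀ : E} (hx₀ : ∀ j ∈ s, 0 < q j x₀) :
    ∃ x, (∀ j ∈ s, 0 < q j x) ∧ ∀ y, (∀ j ∈ s, 0 < q j y) →
      L x - ∑ j ∈ s, a j * Real.log (q j x) ≤ L y - ∑ j ∈ s, a j * Real.log (q j y) := by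
  have : ProperSpace E := FiniteDimensional.proper ℝ E
  obtain ⟨δ, hδ, hle⟩ := exists_pos_mul_norm_le_of_pos_on_cone s q L hL
  set J : E → ℝ := fun x => L x - ∑ j ∈ s, a j * Real.log (q j x) with hJ
  set C : ℝ := 1 + ∑ j ∈ s, a j * ‖q j‖ with hC
  have hCpos : 0 < C := by
    have : 0 ≤ ∑ j ∈ s, a j * ‖q j‖ :=
      Finset.sum_nonneg fun j hj => mul_nonneg (ha j hj).le (norm_nonneg _)
    linarith
  set ε : ℝ := δ / (2 * C) with hε
  have hεpos : 0 < ε := by positivity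
  set D : ℝ := J x₀ - ∑ j ∈ s, a j * (1 + Real.log ε) with hD
  have hterm : ∀ x j, j ∈ s → 0 < q j x →
      0 ≤ a j * (ε * q j x - Real.log (q j x) - (1 + Real.log ε)) := by
    intro x j hj hq
    refine mul_nonneg (ha j hj).le ?_
    have := Real.log_le_sub_one_of_pos (mul_pos hεpos hq)
    rw [Real.log_mul hεpos.ne' hq.ne'] at this
    linarith
  have hbound : ∀ x, (∀ j ∈ s, 0 < q j x) → J x ≤ J x₀ →
      δ / 2 * ‖x‖ + ∑ j ∈ s, a j * (ε * q j x - Real.log (q j x) - (1 + Real.log ε)) ≤ D := by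
    intro x hx hJx
    have h1 := hle x fun j hj => (hx j hj).le
    have h2 : ∑ j ∈ s, a j * q j x ≤ C * ‖x‖ := by
      calc ∑ j ∈ s, a j * q j x ≤ ∑ j ∈ s, a j * ‖q j‖ * ‖x‖ := by
            refine Finset.sum_le_sum fun j hj => ?_
            rw [mul_assoc]
            exact mul_le_mul_of_nonneg_left
              ((le_abs_self _).trans ((q j).le_opNorm x)) (ha j hj).le
        _ ≤ C * ‖x‖ := by
            rw [← Finset.sum_mul, hC]
            nlinarith [norm_nonneg x]
    have h3 : ε * ∑ j ∈ s, a j * q j x ≤ δ / 2 * ‖x‖ := by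
      calc _ ≤ ε * (C * ‖x‖) := mul_le_mul_of_nonneg_left h2 hεpos.le
        _ = δ / 2 * ‖x‖ := by rw [hε]; field_simp
    have h4 : ∑ j ∈ s, a j * (ε * q j x - Real.log (q j x) - (1 + Real.log ε)) =
        ε * ∑ j ∈ s, a j * q j x - ∑ j ∈ s, a j * Real.log (q j x) -
          ∑ j ∈ s, a j * (1 + Real.log ε) := by
      rw [Finset.mul_sum, ← Finset.sum_sub_distrib, ← Finset.sum_sub_distrib]
      exact Finset.sum_congr rfl fun j _ => by ring
    have h5 : L x - ∑ j ∈ s, a j * Real.log (q j x) ≤ J x₀ := hJx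
    linarith
  set K : Set E := Metric.closedBall 0 (2 * D / δ) ∩
    {x | ∀ j ∈ s, Real.exp (-(D / a j + 1 + Real.log ε)) ≤ q j x} with hK
  have hKc : IsCompact K := by
    refine (isCompact_closedBall _ _).inter_right ?_
    simp only [Set.ofPred_forall]
    exact isClosed_biInter fun j _ => isClosed_le continuous_const (q j).continuous
  have hKpos : ∀ x ∈ K, ∀ j ∈ s, 0 < q j x := fun x hx j hj =>
    (Real.exp_pos _).trans_le (hx.2 j hj)
  have hsub : ∀ x, (∀ j ∈ s, 0 < q j x) → J x ≤ J x₀ → x ∈ K := by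
    intro x hx hJx
    have h1 := hbound x hx hJx
    refine ⟨?_, fun j hj => ?_⟩
    · have h2 := Finset.sum_nonneg fun j hj => hterm x j hj (hx j hj)
      rw [mem_closedBall_zero_iff, le_div_iff₀ hδ]
      linarith
    · rw [← Real.le_log_iff_exp_le (hx j hj)]
      have h2 := Finset.single_le_sum (fun j hj => hterm x j hj (hx j hj)) hj
      have h3 : a j * (ε * q j x - Real.log (q j x) - (1 + Real.log ε)) ≤ D := by
        have : 0 ≤ δ / 2 * ‖x‖ := by positivity
        linarith
      rw [← le_div_iff₀' (ha j hj)] at h3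
      have := mul_pos hεpos (hx j hj)
      linarith
  have hJc : ContinuousOn J K := by
    refine L.continuous.continuousOn.sub (continuousOn_finsetSum _ fun j hj => ?_)
    exact continuousOn_const.mul
      ((q j).continuous.continuousOn.log fun x hx => (hKpos x hx j hj).ne')
  obtain ⟨x, hx, hmin⟩ := hKc.exists_isMinOn ⟨x₀, hsub x₀ hx₀ le_rfl⟩ hJc
  refine ⟨x, hKpos x hx, fun y hy => ?_⟩
  rcases le_total (J y) (J x₀) with h | h
  · exact hmin (hsub y hy h)
  · exact (hmin (hsub x₀ hx₀ le_rfl)).trans h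

/-- A minimizer of a linear functional minus a positively weighted sum of logarithms is unique
when the functional is positive on the nonzero points of the closed cone. -/
lemma eq_of_isMin_sub_sum_log {E ι : Type*} [NormedAddCommGroup E] [NormedSpace ℝ E]
    (s : Finset ι) (q : ι → E →L[ℝ] ℝ) (L : E →L[ℝ] ℝ) (a : ι → ℝ) (ha : ∀ j ∈ s, 0 < a j)
    (hL : ∀ x, (∀ j ∈ s, 0 ≤ q j x) → x ≠ 0 → 0 < L x)
    {x y : E} (hx : ∀ j ∈ s, 0 < q j x) (hy : ∀ j ∈ s, 0 < q j y)
    (hxmin : ∀ z, (∀ j ∈ s, 0 < q j z) →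
      L x - ∑ j ∈ s, a j * Real.log (q j x) ≤ L z - ∑ j ∈ s, a j * Real.log (q j z))
    (hymin : ∀ z, (∀ j ∈ s, 0 < q j z) →
      L y - ∑ j ∈ s, a j * Real.log (q j y) ≤ L z - ∑ j ∈ s, a j * Real.log (q j z)) :
    x = y := by
  have h1 := eq_sum_div_of_isMin_sub_sum_log s q L a hx hxmin (x - y)
  have h2 := eq_sum_div_of_isMin_sub_sum_log s q L a hy hymin (x - y)
  have h3 : ∑ j ∈ s, a j * ((q j (x - y)) ^ 2 / (q j x * q j y)) = 0 := by
    rw [← sub_eq_zero.2 (h2.symm.trans h1), ← Finset.sum_sub_distrib]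
    refine Finset.sum_congr rfl fun j hj => ?_
    have := (hx j hj).ne'
    have := (hy j hj).ne'
    rw [map_sub]
    field_simp
  rw [Finset.sum_eq_zero_iff_of_nonneg fun j hj => mul_nonneg (ha j hj).le
    (div_nonneg (sq_nonneg _) (mul_pos (hx j hj) (hy j hj)).le)] at h3
  have h4 : ∀ j ∈ s, q j (x - y) = 0 := by
    intro j hj
    simpa [(ha j hj).ne', (hx j hj).ne', (hy j hj).ne', -map_sub] using h3 j hj
  by_contra hne
  have hpos := hL (x - y) (fun j hj => (h4 j hj).ge) (sub_ne_zero.2 hne)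
  rw [h1, Finset.sum_eq_zero fun j hj => by rw [h4 j hj]; simp] at hpos
  exact hpos.false

/-- Evaluation at a point as a continuous linear functional. -/
def evalCLM (n : ℕ) (z : ℂ) : Coef n →L[ℝ] ℝ :=
  LinearMap.toContinuousLinearMap
    { toFun := fun p => evalR p z
      map_add' := fun p r => by
        simp only [evalR, evalC, Prod.fst_add, Prod.snd_add, Pi.add_apply, map_add,
          Complex.ofReal_add, ← Complex.add_re, add_mul, Finset.sum_add_distrib]
        congr 1
        ring
      map_smul' := fun t p => by
        simp only [evalR, evalC, Prod.smul_fst, Prod.smul_snd, Pi.smul_apply, smul_eq_mul,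
          Complex.real_smul, map_mul, Complex.conj_ofReal, Complex.ofReal_mul, RingHom.id_apply,
          ← Complex.re_ofReal_mul, mul_add, Finset.mul_sum, mul_assoc] }

@[simp]
lemma evalCLM_apply {n : ℕ} (z : ℂ) (p : Coef n) : evalCLM n z p = evalR p z := rfl

/-- The pairing with `c` as a continuous linear functional. -/
def pairCLM {n : ℕ} (c : Coef n) : Coef n →L[ℝ] ℝ :=
  LinearMap.toContinuousLinearMap
    { toFun := fun p => pairCP c p
      map_add' := fun p r => by
        simp only [pairCP, Prod.fst_add, Prod.snd_add, Pi.add_apply, map_add, mul_add,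
          Complex.add_re, Finset.sum_add_distrib]
        ring
      map_smul' := fun t p => by
        simp only [pairCP, Prod.smul_fst, Prod.smul_snd, Pi.smul_apply, smul_eq_mul,
          Complex.real_smul, map_mul, Complex.conj_ofReal, RingHom.id_apply, mul_add,
          Finset.mul_sum, mul_left_comm _ (t : ℂ), Complex.re_ofReal_mul, mul_left_comm _ t] }

@[simp]
lemma pairCLM_apply {n : ℕ} (c p : Coef n) : pairCLM c p = pairCP c p := rfl

lemma JP_eq {n : ℕ} (N : ℕ) (c P Q : Coef n) :
    JP N c P Q = pairCLM c Q - ∑ j ∈ idxs N,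
      evalR P (zet N j) / (2 * N) * Real.log (evalCLM n (zet N j) Q) := by
  simp only [JP, pairCLM_apply, evalCLM_apply, Finset.mul_sum]
  congr 1
  exact Finset.sum_congr rfl fun j _ => by ring

lemma inv_zet (N : ℕ) (j : ℤ) : (zet N j)⁻¹ = (starRingEnd ℂ) (zet N j) := by
  rw [zet, ← Complex.exp_neg, ← Complex.exp_conj]
  congr 1
  simp [neg_div]

lemma evalR_const {n : ℕ} (t : ℝ) (z : ℂ) : evalR ((t, 0) : Coef n) z = t := by
  simp [evalR, evalC]

lemma evalR_single {n : ℕ} (N : ℕ) (j : ℤ) (k : Fin n) (w : ℂ) :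
    evalR ((0, Pi.single k w) : Coef n) (zet N j) =
      2 * ((starRingEnd ℂ) w * zet N j ^ ((k : ℕ) + 1)).re := by
  rw [evalR, evalC, Finset.sum_eq_single k]
  · simp only [Pi.single_eq_same, inv_zet, ← map_pow, Complex.add_re, Complex.mul_re,
      Complex.conj_re, Complex.conj_im, Complex.ofReal_re]
    ring
  · intro i _ hi
    simp [Pi.single_eq_of_ne hi]
  · simp

lemma pairCP_single {n : ℕ} (c : Coef n) (k : Fin n) (w : ℂ) :
    pairCP c (0, Pi.single k w) = 2 * ((starRingEnd ℂ) w * c.2 k).re := by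
  rw [pairCP, Finset.sum_eq_single k]
  · simp [mul_comm]
  · intro i _ hi
    simp [Pi.single_eq_of_ne hi]
  · simp

lemma re_mul_dmom (N : ℕ) (Φ : ℤ → ℝ) (k : ℤ) (w : ℂ) :
    (w * dmom N Φ k).re = ∑ j ∈ idxs N, Φ j / (2 * N) * (w * zet N j ^ k).re := by
  rw [dmom, Finset.mul_sum, Finset.mul_sum, Complex.re_sum]
  refine Finset.sum_congr rfl fun j _ => ?_
  rw [← Complex.re_ofReal_mul]
  congr 1
  push_cast
  ring

/-- Stationarity of the dual functional in every direction is the moment condition. -/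
lemma momCond_of_pairCP_eq {n : ℕ} (N : ℕ) (c : Coef n) (Φ : ℤ → ℝ)
    (h : ∀ p : Coef n, pairCP c p = ∑ j ∈ idxs N, Φ j / (2 * N) * evalR p (zet N j)) :
    MomCond N c Φ := by
  refine ⟨?_, fun k => ?_⟩
  · have h1 := h (1, 0)
    simp only [evalR_const, pairCP] at h1
    simp only [dmom, zpow_zero, one_mul]
    have h2 : c.1 = ∑ j ∈ idxs N, Φ j / (2 * N) := by simpa using h1
    rw [h2, Finset.mul_sum]
    push_cast
    exact Finset.sum_congr rfl fun j _ => by ring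
  · set w : ℂ := dmom N Φ ((k : ℕ) + 1) - c.2 k with hw
    have h1 := h (0, Pi.single k w)
    have h2 := re_mul_dmom N Φ ((k : ℕ) + 1) ((starRingEnd ℂ) w)
    have h3 : ((starRingEnd ℂ) w * c.2 k).re =
        ((starRingEnd ℂ) w * dmom N Φ ((k : ℕ) + 1)).re := by
      rw [pairCP_single] at h1
      simp only [evalR_single] at h1
      rw [h2, ← mul_right_inj' (two_ne_zero' ℝ), h1, Finset.mul_sum]
      refine Finset.sum_congr rfl fun j _ => ?_
      norm_cast
      ring
    have h4 : ((starRingEnd ℂ) w * w).re = 0 := by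
      rw [hw, mul_sub, Complex.sub_re, ← hw, h3, sub_self]
    rw [← Complex.normSq_eq_conj_mul_self, Complex.ofReal_re, Complex.normSq_eq_zero] at h4
    exact sub_eq_zero.1 h4

/-- `J_P` attains its minimum over `𝔓₊(N)` at a unique point `Q̂`, and
`Φ(ζ_j) = P(ζ_j)/Q̂(ζ_j)` satisfies the moment conditions for `c`. -/
theorem dual_problem_unique_minimizer
    (n N : ℕ) (hn : 1 ≤ n) (hnN : n < N)
    (c : Coef n) (hc : c ∈ Cplus n N) (P : Coef n) (hP : P ∈ Pplus n N) :
    (∃! Q : Coef n, Q ∈ Pplus n N ∧ ∀ Q' ∈ Pplus n N, JP N c P Q ≤ JP N c P Q') ∧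
    ∀ Q : Coef n, Q ∈ Pplus n N → (∀ Q' ∈ Pplus n N, JP N c P Q ≤ JP N c P Q') →
      MomCond N c (phiOf N P Q) := by
  have hN : (0 : ℝ) < N := by exact_mod_cast (Nat.zero_le n).trans_lt hnN
  have ha : ∀ j ∈ idxs N, 0 < evalR P (zet N j) / (2 * N) :=
    fun j hj => div_pos (hP j hj) (by positivity)
  have hstat : ∀ Q : Coef n, Q ∈ Pplus n N →
      (∀ Q' ∈ Pplus n N, JP N c P Q ≤ JP N c P Q') → MomCond N c (phiOf N P Q) := by
    intro Q hQ hmin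
    simp only [JP_eq] at hmin
    refine momCond_of_pairCP_eq N c _ fun p => ?_
    refine (eq_sum_div_of_isMin_sub_sum_log (idxs N) (fun j => evalCLM n (zet N j)) (pairCLM c)
      _ hQ hmin p).trans (Finset.sum_congr rfl fun j _ => ?_)
    simp only [phiOf, evalCLM_apply]
    ring
  refine ⟨?_, hstat⟩
  simp only [JP_eq]
  obtain ⟨Q, hQ, hmin⟩ := exists_isMin_sub_sum_log (idxs N) (fun j => evalCLM n (zet N j))
    (pairCLM c) _ ha hc (x₀ := (1, 0)) fun j _ => by simp [evalR_const]
  refine ⟨Q, ⟨hQ, hmin⟩, fun R hR => ?_⟩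
  exact eq_of_isMin_sub_sum_log (idxs N) (fun j => evalCLM n (zet N j)) (pairCLM c) _ ha hc
    hR.1 hQ hR.2 hmin
end
end

section
/- The feasibility cones are nested and exhaust ℭ_+ in the limit: 𝔓_+ ⊆ … ⊆ 𝔓_+(4N) ⊆ 𝔓_+(2N) ⊆ 𝔓_+(N), hence ℭ_+(N) ⊆ ℭ_+(2N) ⊆ ℭ_+(4N) ⊆ … ⊆ ℭ_+; moreover, for every c ∈ ℭ_+ there exists an integer N_0 > n such that c ∈ ℭ_+(N) for all N ≥ N_0. -/
open Complex Finset Filter Topology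

noncomputable section

theorem zet_eq_exp (N : ℕ) (j : ℤ) :
    zet N j = Complex.exp (((Real.pi * j / N : ℝ) : ℂ) * Complex.I) := by
  unfold zet
  congr 1
  push_cast
  ring

theorem zet_two_mul (N : ℕ) (j : ℤ) : zet (2 * N) (2 * j) = zet N j := by
  unfold zet
  congr 1
  push_cast
  rw [mul_left_comm, mul_div_mul_left _ _ two_ne_zero]

theorem zet_neg_self {N : ℕ} (hN : 0 < N) : zet N (-N) = zet N N := by
  have hN' : (N : ℂ) ≠ 0 := by exact_mod_cast hN.ne'
  unfold zet
  push_cast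
  rw [mul_neg, neg_div, mul_div_cancel_right₀ _ hN', Complex.exp_neg, Complex.exp_pi_mul_I]
  norm_num

theorem two_mul_mem_idxs {N : ℕ} {j : ℤ} (hj : j ∈ idxs N) : 2 * j ∈ idxs (2 * N) := by
  simp only [idxs, Finset.mem_Icc] at hj ⊢
  push_cast
  omega

theorem angle_mem_Icc {N : ℕ} (hN : 0 < N) {j : ℤ} (hj : j ∈ idxs N) :
    Real.pi * j / N ∈ Set.Icc (-Real.pi) Real.pi := by
  simp only [idxs, Finset.mem_Icc] at hj
  have hN' : (0 : ℝ) < N := by exact_mod_cast hN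
  have h1 : -(N : ℝ) ≤ j := by exact_mod_cast (by omega : -(N : ℤ) ≤ j)
  have h2 : (j : ℝ) ≤ N := by exact_mod_cast hj.2
  constructor
  · rw [le_div_iff₀ hN']
    nlinarith [Real.pi_pos]
  · rw [div_le_iff₀ hN']
    nlinarith [Real.pi_pos]

theorem evalR_zet_nonneg {n N : ℕ} (hN : 0 < N) {p : Coef n} (hp : p ∈ Pnn n N) {j : ℤ}
    (h1 : -(N : ℤ) ≤ j) (h2 : j ≤ N) : 0 ≤ evalR p (zet N j) := by
  rcases h1.eq_or_lt with rfl | h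
  · rw [zet_neg_self hN]
    exact hp _ (by simp only [idxs, Finset.mem_Icc]; omega)
  · exact hp _ (by simp only [idxs, Finset.mem_Icc]; omega)

theorem continuous_evalR_exp (n : ℕ) :
    Continuous fun x : Coef n × ℝ => evalR x.1 (Complex.exp (x.2 * Complex.I)) := by
  unfold evalR evalC
  simp only [← Complex.exp_neg]
  have : Continuous (starRingEnd ℂ) := Complex.continuous_conj
  fun_prop

theorem continuous_pairCP {n : ℕ} (c : Coef n) : Continuous (pairCP c) := by
  unfold pairCP
  have : Continuous (starRingEnd ℂ) := Complex.continuous_conj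
  fun_prop

theorem evalR_smul {n : ℕ} (r : ℝ) (p : Coef n) (z : ℂ) : evalR (r • p) z = r * evalR p z := by
  have : evalC (r • p) z = r * evalC p z := by
    simp only [evalC, Prod.smul_fst, Prod.smul_snd, Pi.smul_apply, smul_eq_mul,
      Complex.real_smul, Complex.ofReal_mul, map_mul, Complex.conj_ofReal, mul_add,
      Finset.mul_sum, mul_assoc]
  rw [evalR, this, Complex.re_ofReal_mul, evalR]

theorem pairCP_smul {n : ℕ} (r : ℝ) (c p : Coef n) : pairCP c (r • p) = r * pairCP c p := by
  simp only [pairCP, Prod.smul_fst, Prod.smul_snd, Pi.smul_apply, smul_eq_mul,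
    Complex.real_smul, map_mul, Complex.conj_ofReal, mul_add, Finset.mul_sum]
  congr 1
  · ring
  · refine Finset.sum_congr rfl fun k _ => ?_
    rw [mul_left_comm (c.2 k), Complex.re_ofReal_mul]
    ring

theorem exists_unit_of_notMem_Cplus {n N : ℕ} {c : Coef n} (hc : c ∉ Cplus n N) :
    ∃ p ∈ Metric.sphere (0 : Coef n) 1, p ∈ Pnn n N ∧ pairCP c p ≤ 0 := by
  simp only [Cplus, Set.mem_ofPred_eq, not_forall, not_lt] at hc
  obtain ⟨p, hp, hp0, hpc⟩ := hc
  refine ⟨‖p‖⁻¹ • p, ?_, fun j hj => ?_, ?_⟩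
  · rw [mem_sphere_zero_iff_norm, norm_smul, norm_inv, norm_norm,
      inv_mul_cancel₀ (norm_ne_zero_iff.2 hp0)]
  · rw [evalR_smul]
    exact mul_nonneg (by positivity) (hp j hj)
  · rw [pairCP_smul]
    exact mul_nonpos_of_nonneg_of_nonpos (by positivity) hpc

/-- The grid point `π ⌊θ N / π⌋ / N` just below `θ` approaches `θ` as `N → ∞`. -/
theorem tendsto_grid_angle (θ : ℝ) :
    Tendsto (fun N : ℕ => Real.pi * (⌊θ / Real.pi * N⌋ : ℤ) / N) atTop (𝓝 θ) := by
  have hlow : Tendsto (fun N : ℕ => θ - Real.pi / N) atTop (𝓝 θ) := by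
    simpa using tendsto_const_nhds.sub (tendsto_const_div_atTop_nhds_zero_nat Real.pi)
  refine tendsto_of_tendsto_of_tendsto_of_le_of_le' hlow tendsto_const_nhds ?_ ?_ <;>
    filter_upwards [eventually_gt_atTop 0] with N hN
  all_goals
    have hN' : (0 : ℝ) < N := by exact_mod_cast hN
    have hθ : Real.pi * (θ / Real.pi * N) = θ * N := by
      field_simp
  · rw [le_div_iff₀ hN', sub_mul, div_mul_cancel₀ _ hN'.ne', ← hθ]
    nlinarith [Real.pi_pos, Int.lt_floor_add_one (θ / Real.pi * N)]
  · rw [div_le_iff₀ hN', ← hθ]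
    exact mul_le_mul_of_nonneg_left (Int.floor_le _) Real.pi_pos.le

theorem mem_PnnC_of_tendsto {n : ℕ} {u : ℕ → ℕ} {q : ℕ → Coef n} {p : Coef n}
    (hu : Tendsto u atTop atTop) (hq : ∀ m, q m ∈ Pnn n (u m)) (hp : Tendsto q atTop (𝓝 p)) :
    p ∈ PnnC n := by
  intro θ hθ
  have hlim := ((continuous_evalR_exp n).tendsto (p, θ)).comp
    (hp.prodMk_nhds ((tendsto_grid_angle θ).comp hu))
  refine ge_of_tendsto hlim ?_
  filter_upwards [hu.eventually_gt_atTop 0] with m hm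
  have h1 : -1 ≤ θ / Real.pi := by
    rw [le_div_iff₀ Real.pi_pos]
    linarith [hθ.1]
  have h2 : θ / Real.pi ≤ 1 := by
    rw [div_le_iff₀ Real.pi_pos]
    linarith [hθ.2]
  have hm' : (0 : ℝ) < u m := by exact_mod_cast hm
  have h := evalR_zet_nonneg hm (hq m) (j := ⌊θ / Real.pi * u m⌋)
    (Int.le_floor.2 (by push_cast; nlinarith))
    (by exact_mod_cast (Int.floor_le _).trans (by nlinarith : θ / Real.pi * u m ≤ u m))
  rwa [zet_eq_exp] at h

theorem PplusC_subset_Pplus {n N : ℕ} (hN : 0 < N) : PplusC n ⊆ Pplus n N := fun p hp j hj => by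
  rw [zet_eq_exp]
  exact hp _ (angle_mem_Icc hN hj)

theorem PnnC_subset_Pnn {n N : ℕ} (hN : 0 < N) : PnnC n ⊆ Pnn n N := fun p hp j hj => by
  rw [zet_eq_exp]
  exact hp _ (angle_mem_Icc hN hj)

theorem Pplus_two_mul_subset (n N : ℕ) : Pplus n (2 * N) ⊆ Pplus n N := fun p hp j hj => by
  rw [← zet_two_mul]
  exact hp _ (two_mul_mem_idxs hj)

theorem Pnn_two_mul_subset (n N : ℕ) : Pnn n (2 * N) ⊆ Pnn n N := fun p hp j hj => by
  rw [← zet_two_mul]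
  exact hp _ (two_mul_mem_idxs hj)

/-- By compactness of the unit sphere, `c ∈ ℭ₊` lies in `ℭ₊(N)` for all large `N`. -/
theorem eventually_mem_Cplus {n : ℕ} {c : Coef n} (hc : c ∈ CplusC n) :
    ∀ᶠ N in atTop, c ∈ Cplus n N := by
  by_contra hcon
  obtain ⟨u, hu, hcu⟩ := extraction_of_frequently_atTop (not_eventually.1 hcon)
  choose q hqs hq hqc using fun m => exists_unit_of_notMem_Cplus (hcu m)
  obtain ⟨p, hps, φ, hφ, hlim⟩ := (isCompact_sphere (0 : Coef n) 1).tendsto_subseq hqs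
  have hp : p ∈ PnnC n :=
    mem_PnnC_of_tendsto (hu.tendsto_atTop.comp hφ.tendsto_atTop) (fun m => hq (φ m)) hlim
  have hp0 : p ≠ 0 := ne_zero_of_mem_unit_sphere (⟨p, hps⟩ : Metric.sphere (0 : Coef n) 1)
  have hle : pairCP c p ≤ 0 :=
    le_of_tendsto' (((continuous_pairCP c).tendsto p).comp hlim) fun m => hqc (φ m)
  exact (hc p hp hp0).not_ge hle

/-- **Proposition 5.** The cones are nested: `𝔓₊ ⊆ 𝔓₊(2N) ⊆ 𝔓₊(N)`, hence
`ℭ₊(N) ⊆ ℭ₊(2N) ⊆ ℭ₊`; and every `c ∈ ℭ₊` lies in `ℭ₊(N)` for all sufficiently large `N`. -/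
theorem feasibility_cones_nested_and_exhaustive (n : ℕ) (hn : 1 ≤ n) :
    (∀ N : ℕ, n < N → PplusC n ⊆ Pplus n N ∧ Pplus n (2 * N) ⊆ Pplus n N) ∧
    (∀ N : ℕ, n < N → Cplus n N ⊆ Cplus n (2 * N) ∧ Cplus n N ⊆ CplusC n) ∧
    (∀ c ∈ CplusC n, ∃ N₀ : ℕ, n < N₀ ∧ ∀ N : ℕ, N₀ ≤ N → c ∈ Cplus n N) := by
  refine ⟨fun N hN => ⟨PplusC_subset_Pplus (by omega), Pplus_two_mul_subset n N⟩,
    fun N hN => ⟨fun c hc p hp => hc p (Pnn_two_mul_subset n N hp),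
      fun c hc p hp => hc p (PnnC_subset_Pnn (by omega) hp)⟩, fun c hc => ?_⟩
  obtain ⟨M, hM⟩ := eventually_atTop.1 (eventually_mem_Cplus hc)
  exact ⟨max M (n + 1), by omega, fun N hN => hM N (by omega)⟩
end
end
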